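/- Let n ≥ 1, let P be a finite bounded graded poset of rank n+1 with a finite group G acting on it by order-preserving bijections, let t be a positive integer, and let Q be the bounded graded poset of rank n+1 obtained by adjoining a new minimum and a new maximum to (P⁻ ∗ T_{t,n})₋. Then for every S ⊆ [n] and every g ∈ G: α_Q(S)(g) = φ_t(S) · α_P(S)(g), where for S = {s₁ < s₂ < ⋯ < s_k}, φ_t(S) := [s₁+1]_t [s₂−s₁+1]_t ⋯ [s_k−s_{k−1}+1]_t (and φ_t(∅) = 1). -/

import Mathlib

/-!
STATEMENT 2: Let n ≥ 1, P a finite bounded graded poset of rank n+1 with a finite group G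
acting by order-preserving bijections, t a positive integer, and Q the bounded graded poset
of rank n+1 obtained by adjoining a new minimum and maximum to (P⁻ ∗ T_{t,n})₋.  Then for
every S ⊆ [n] and every g ∈ G: α_Q(S)(g) = φ_t(S) · α_P(S)(g).
-/

noncomputable section

/-- The number of maximal chains of the subposet of `(X, r)` induced on `A`, all of whose
elements satisfy the predicate `fix`.  A maximal chain of the subposet on `A` is a chain
`C ⊆ A` not properly contained in any other chain contained in `A`. -/
def nFixedMaxChains {X : Type} (r : X → X → Prop) (A : Set X) (fix : X → Prop) : ℕ :=
  Nat.card {C : Set X // C ⊆ A ∧ IsChain r C ∧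
    (∀ C' : Set X, C' ⊆ A → IsChain r C' → C ⊆ C' → C' = C) ∧ ∀ x ∈ C, fix x}

/-- `α_P(S)(g)`: the number of maximal chains of the rank-selected subposet
`P_S = {x ∈ P : rk x ∈ S} ∪ {⊥, ⊤}` that are fixed pointwise by `g`. -/
def alphaP (P : Type) [PartialOrder P] [BoundedOrder P]
    (G : Type) [Group G] [MulAction G P] (rk : P → ℕ) (S : Finset ℕ) (g : G) : ℕ :=
  nFixedMaxChains (· ≤ · : P → P → Prop) {x : P | rk x ∈ S ∨ x = ⊥ ∨ x = ⊤}
    (fun x => g • x = x)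

/-- `β_P(S)(g) = Σ_{T ⊆ S} (−1)^{|S∖T|} α_P(T)(g)`. -/
def betaP (P : Type) [PartialOrder P] [BoundedOrder P]
    (G : Type) [Group G] [MulAction G P] (rk : P → ℕ) (S : Finset ℕ) (g : G) : ℤ :=
  ∑ T ∈ S.powerset, (-1 : ℤ) ^ ((S \ T).card) * (alphaP P G rk T g : ℤ)

/-- The Rees-product order relation on pairs `(p, q)` of an element of `P` and a word `q`
(an element of `T_{t,·}`, ranked by its length): `(p₁,q₁) ⪯ (p₂,q₂)` iff `p₁ ≤ p₂`, `q₁` is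
a prefix of `q₂`, and `rk p₂ − rk p₁ ≥ length q₂ − length q₁` (stated additively). -/
def reesLe (P : Type) [PartialOrder P] (rk : P → ℕ) {t : ℕ}
    (a b : P × List (Fin t)) : Prop :=
  a.1 ≤ b.1 ∧ a.2 <+: b.2 ∧ rk a.1 + b.2.length ≤ rk b.1 + a.2.length

/-- The underlying type of `(P⁻ ∗ T_{t,n})₋`: pairs `(p, q)` with `p ≠ ⊤`, `q` a word of
length ≤ n over a `t`-letter alphabet with `length q ≤ rk p`, the minimum `(⊥, [])` removed. -/
abbrev QCore (P : Type) [PartialOrder P] [BoundedOrder P] (rk : P → ℕ) (t n : ℕ) : Type :=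
  {pq : P × List (Fin t) // pq.1 ≠ ⊤ ∧ pq.2.length ≤ n ∧ pq.2.length ≤ rk pq.1 ∧
    ¬(pq.1 = ⊥ ∧ pq.2 = [])}

/-- The poset `Q` obtained from `(P⁻ ∗ T_{t,n})₋` by adjoining a new minimum (`none`) and a
new maximum (`some none`). -/
abbrev QType (P : Type) [PartialOrder P] [BoundedOrder P] (rk : P → ℕ) (t n : ℕ) : Type :=
  Option (Option (QCore P rk t n))

/-- The order relation of `Q`. -/
def QLe (P : Type) [PartialOrder P] [BoundedOrder P] (rk : P → ℕ) (t n : ℕ) :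
    QType P rk t n → QType P rk t n → Prop
  | none, _ => True
  | some none, b => b = some none
  | some (some _), none => False
  | some (some _), some none => True
  | some (some c), some (some c') => reesLe P rk c.val c'.val

/-- The rank function of `Q` (a bounded graded poset of rank `n+1`). -/
def QRank (P : Type) [PartialOrder P] [BoundedOrder P] (rk : P → ℕ) (t n : ℕ) :
    QType P rk t n → ℕ
  | none => 0
  | some none => n + 1
  | some (some c) => rk c.val.1

/-- The fixed-point predicate on `Q` for the induced `G`-action `g • (p, q) = (g • p, q)`:
the new minimum and maximum are fixed, and a core element `(p,q)` is fixed iff `g • p = p`. -/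
def QFix (P : Type) [PartialOrder P] [BoundedOrder P]
    (G : Type) [Group G] [MulAction G P] (rk : P → ℕ) (t n : ℕ) (g : G) :
    QType P rk t n → Prop
  | some (some c) => g • c.val.1 = c.val.1
  | _ => True

/-- `α_Q(S)(g)` for the poset `Q`. -/
def alphaQ (P : Type) [PartialOrder P] [BoundedOrder P]
    (G : Type) [Group G] [MulAction G P] (rk : P → ℕ) (t n : ℕ) (S : Finset ℕ) (g : G) : ℕ :=
  nFixedMaxChains (QLe P rk t n)
    {x : QType P rk t n | QRank P rk t n x ∈ S ∨ x = none ∨ x = some none}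
    (QFix P G rk t n g)

/-- `β_Q(S)(g)`. -/
def betaQ (P : Type) [PartialOrder P] [BoundedOrder P]
    (G : Type) [Group G] [MulAction G P] (rk : P → ℕ) (t n : ℕ) (S : Finset ℕ) (g : G) : ℤ :=
  ∑ T ∈ S.powerset, (-1 : ℤ) ^ ((S \ T).card) * (alphaQ P G rk t n T g : ℤ)


/-- `[m]_t = 1 + t + ⋯ + t^{m-1}` as a polynomial in the indeterminate `t` over `ℤ`. -/
def qt (m : ℕ) : Polynomial ℤ := ∑ i ∈ Finset.range m, Polynomial.X ^ i

/-- Helper: given the previous element `prev` and the (sorted, increasing) list of remaining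
elements `s₁ < s₂ < ⋯`, returns `[s₁ - prev + 1]_t [s₂ - s₁ + 1]_t ⋯`. -/
def phiAux : ℕ → List ℕ → Polynomial ℤ
  | _, [] => 1
  | prev, s :: rest => qt (s - prev + 1) * phiAux s rest

/-- `φ_t(S) = [s₁+1]_t [s₂−s₁+1]_t ⋯ [s_k−s_{k−1}+1]_t` for `S = {s₁ < s₂ < ⋯ < s_k}`,
with `φ_t(∅) = 1`. -/
def phi (S : Finset ℕ) : Polynomial ℤ := phiAux 0 (S.sort (· ≤ ·))

/-- A choice of one element of each rank in `S`, increasing for `r` and satisfying `fix`. -/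
abbrev RankSection {X : Type} (r : X → X → Prop) (ρ : X → ℕ) (S : Finset ℕ) (fix : X → Prop) :
    Type :=
  {f : S → X // (∀ s, ρ (f s) = s) ∧ (∀ s s', s < s' → r (f s) (f s')) ∧ ∀ s, fix (f s)}

section MaximalChains

variable {X : Type} {r : X → X → Prop} {ρ : X → ℕ} {bot top : X} {S : Finset ℕ}

theorem IsChain.eq_of_rank_eq (strict : ∀ x y, r x y → x ≠ y → ρ x < ρ y) {C : Set X}
    (hC : IsChain r C) {x y : X} (hx : x ∈ C) (hy : y ∈ C) (h : ρ x = ρ y) : x = y := by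
  by_contra hne
  rcases hC hx hy hne with h' | h'
  · exact absurd (strict _ _ h' hne) (by omega)
  · exact absurd (strict _ _ h' (Ne.symm hne)) (by omega)

theorem IsChain.rel_of_rank_lt (strict : ∀ x y, r x y → x ≠ y → ρ x < ρ y) {C : Set X}
    (hC : IsChain r C) {x y : X} (hx : x ∈ C) (hy : y ∈ C) (h : ρ x < ρ y) : r x y := by
  have hne : x ≠ y := by rintro rfl; omega
  rcases hC hx hy hne with h' | h'
  · exact h'
  · exact absurd (strict _ _ h' (Ne.symm hne)) (by omega)

/-- A maximal chain of a rank-selected subposet meets every selected rank. -/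
theorem exists_rank_eq_of_maximal_chain
    (trans : ∀ x y z, r x y → r y z → r x z)
    (strict : ∀ x y, r x y → x ≠ y → ρ x < ρ y)
    (interp : ∀ x y s, r x y → ρ x < s → s < ρ y → ∃ z, r x z ∧ r z y ∧ ρ z = s)
    (hbot : ∀ x, r bot x) (htop : ∀ x, r x top)
    (hS : ∀ s ∈ S, ρ bot < s ∧ s < ρ top) {C : Set X}
    (hCA : C ⊆ {x | ρ x ∈ S ∨ x = bot ∨ x = top}) (hC : IsChain r C)
    (hmax : ∀ C' : Set X, C' ⊆ {x | ρ x ∈ S ∨ x = bot ∨ x = top} → IsChain r C' → C ⊆ C' →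
      C' = C) : bot ∈ C ∧ top ∈ C ∧ ∀ s ∈ S, ∃ x ∈ C, ρ x = s := by
  have key : ∀ z, (ρ z ∈ S ∨ z = bot ∨ z = top) → (∀ c ∈ C, z ≠ c → r z c ∨ r c z) → z ∈ C := by
    intro z hz hc
    rw [← hmax (insert z C) (Set.insert_subset hz hCA) (hC.insert hc) (Set.subset_insert _ _)]
    exact Set.mem_insert _ _
  have hb : bot ∈ C := key bot (by simp) fun c _ _ => Or.inl (hbot c)
  have ht : top ∈ C := key top (by simp) fun c _ _ => Or.inr (htop c)
  refine ⟨hb, ht, fun s hs => ?_⟩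
  by_contra! hno
  obtain ⟨x, ⟨hxC, hxs⟩, hxmax⟩ : ∃ x, (x ∈ C ∧ ρ x < s) ∧ ∀ c, (c ∈ C ∧ ρ c < s) → ρ c ≤ ρ x := by
    obtain ⟨x, hx, hx'⟩ := (measure (fun c => s - ρ c)).wf.has_min {c | c ∈ C ∧ ρ c < s}
      ⟨bot, hb, (hS s hs).1⟩
    refine ⟨x, hx, fun c hc => ?_⟩
    have h1 : ¬ (s - ρ c < s - ρ x) := hx' c hc
    have h2 : ρ c < s := hc.2
    omega
  obtain ⟨y, ⟨hyC, hys⟩, hymin⟩ : ∃ y, (y ∈ C ∧ s < ρ y) ∧ ∀ c, (c ∈ C ∧ s < ρ c) → ρ y ≤ ρ c := by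
    obtain ⟨y, hy, hy'⟩ := (measure ρ).wf.has_min {c | c ∈ C ∧ s < ρ c}
      ⟨top, ht, (hS s hs).2⟩
    exact ⟨y, hy, fun c hc => not_lt.1 (hy' c hc)⟩
  obtain ⟨z, hxz, hzy, hz⟩ :=
    interp x y s (hC.rel_of_rank_lt strict hxC hyC (hxs.trans hys)) hxs hys
  refine hno z (key z (Or.inl (hz ▸ hs)) fun c hc _ => ?_) hz
  rcases lt_or_gt_of_ne (hno c hc) with h | h
  · right
    rcases (hxmax c ⟨hc, h⟩).lt_or_eq with h' | h'
    · exact trans _ _ _ (hC.rel_of_rank_lt strict hc hxC h') hxz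
    · rwa [hC.eq_of_rank_eq strict hc hxC h']
  · left
    rcases (hymin c ⟨hc, h⟩).lt_or_eq with h' | h'
    · exact trans _ _ _ hzy (hC.rel_of_rank_lt strict hyC hc h')
    · rwa [← hC.eq_of_rank_eq strict hyC hc h']

/-- Maximal chains of a rank-selected subposet correspond to sections of the rank function. -/
theorem nFixedMaxChains_eq_card_rankSection
    (trans : ∀ x y z, r x y → r y z → r x z)
    (strict : ∀ x y, r x y → x ≠ y → ρ x < ρ y)
    (interp : ∀ x y s, r x y → ρ x < s → s < ρ y → ∃ z, r x z ∧ r z y ∧ ρ z = s)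
    (hbot : ∀ x, r bot x) (htop : ∀ x, r x top)
    (hS : ∀ s ∈ S, ρ bot < s ∧ s < ρ top) {fix : X → Prop} (fbot : fix bot) (ftop : fix top) :
    nFixedMaxChains r {x | ρ x ∈ S ∨ x = bot ∨ x = top} fix =
      Nat.card (RankSection r ρ S fix) := by
  symm
  unfold nFixedMaxChains
  refine Nat.card_eq_of_bijective
    (fun f => ⟨Set.range f.1 ∪ {bot, top}, ?_, ?_, ?_, ?_⟩) ⟨?_, ?_⟩
  · rintro x (⟨s, rfl⟩ | rfl | rfl)
    · left
      rw [f.2.1]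
      exact s.2
    · simp
    · simp
  · rintro x (⟨s, rfl⟩ | rfl | rfl) y (⟨s', rfl⟩ | rfl | rfl) hne
    · rcases lt_trichotomy s s' with h | rfl | h
      · exact Or.inl (f.2.2.1 _ _ h)
      · exact absurd rfl hne
      · exact Or.inr (f.2.2.1 _ _ h)
    all_goals first
      | exact Or.inl (hbot _)
      | exact Or.inr (hbot _)
      | exact Or.inl (htop _)
      | exact Or.inr (htop _)
  · intro C' hA hC' hsub
    refine Set.Subset.antisymm (fun c hc => ?_) hsub
    rcases hA hc with h | rfl | rfl
    · exact Or.inl ⟨⟨ρ c, h⟩, hC'.eq_of_rank_eq strict (hsub (Or.inl ⟨_, rfl⟩)) hc (f.2.1 _)⟩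
    · simp
    · simp
  · rintro x (⟨s, rfl⟩ | rfl | rfl)
    · exact f.2.2.2 s
    · exact fbot
    · exact ftop
  · intro f f' h
    have h : Set.range f.1 ∪ {bot, top} = Set.range f'.1 ∪ {bot, top} := congrArg Subtype.val h
    ext s
    have hmem : f.1 s ∈ Set.range f'.1 ∪ {bot, top} := h ▸ Or.inl ⟨s, rfl⟩
    have hs := f.2.1 s
    rcases hmem with ⟨s', h'⟩ | h' | h'
    · rw [← h', f'.2.1 s'] at hs
      rw [← h', Subtype.ext hs]
    · have := (hS s s.2).1
      rw [← hs, h'] at this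
      exact absurd this (lt_irrefl _)
    · have := (hS s s.2).2
      rw [← hs, h'] at this
      exact absurd this (lt_irrefl _)
  · rintro ⟨C, hCA, hC, hmax, hfix⟩
    obtain ⟨hb, ht, hex⟩ :=
      exists_rank_eq_of_maximal_chain trans strict interp hbot htop hS hCA hC hmax
    choose f hfC hf using fun s : S => hex s s.2
    refine ⟨⟨f, hf, fun s s' h => hC.rel_of_rank_lt strict (hfC s) (hfC s') ?_,
      fun s => hfix _ (hfC s)⟩, Subtype.ext (Set.Subset.antisymm ?_ fun c hc => ?_)⟩
    · rw [hf, hf]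
      exact h
    · rintro x (⟨s, rfl⟩ | rfl | rfl)
      · exact hfC s
      · exact hb
      · exact ht
    · rcases hCA hc with h | rfl | rfl
      · exact Or.inl ⟨⟨ρ c, h⟩, hC.eq_of_rank_eq strict (hfC _) hc (hf _)⟩
      · simp
      · simp

end MaximalChains

section Words

/-- Prefix-increasing systems of words indexed by `S` over a `t`-letter alphabet, in which the
lengths grow at most as fast as the indices, starting from length zero at index `m`. -/
abbrev WordSystem (t m : ℕ) (S : Finset ℕ) : Type :=
  {w : S → List (Fin t) // (∀ s, m + (w s).length ≤ s) ∧
    ∀ s s', s < s' → w s <+: w s' ∧ (s : ℕ) + (w s').length ≤ s' + (w s).length}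

theorem card_words_length_le (t d : ℕ) :
    (Nat.card {w : List (Fin t) // w.length ≤ d} : ℤ) = (qt (d + 1)).eval (t : ℤ) := by
  let e : {w : List (Fin t) // w.length ≤ d} ≃ Σ i : Fin (d + 1), List.Vector (Fin t) i :=
    { toFun := fun w => ⟨⟨w.1.length, Nat.lt_succ_of_le w.2⟩, ⟨w.1, rfl⟩⟩
      invFun := fun v => ⟨v.2.1, by rw [v.2.2]; exact Nat.le_of_lt_succ v.1.2⟩
      left_inv := fun w => rfl
      right_inv := by
        rintro ⟨⟨i, hi⟩, ⟨w, hw⟩⟩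
        obtain rfl : w.length = i := hw
        rfl }
  rw [Nat.card_congr e, Nat.card_eq_fintype_card, Fintype.card_sigma]
  simp [qt, Polynomial.eval_finsetSum, Finset.sum_range]

/-- Splitting off the word at the smallest index. -/
theorem card_wordSystem_insert (t m a : ℕ) (S : Finset ℕ) (hma : m ≤ a) (ha : ∀ s ∈ S, a < s) :
    Nat.card (WordSystem t m (insert a S)) =
      Nat.card ({w : List (Fin t) // w.length ≤ a - m} × WordSystem t a S) := by
  have haS : a ∉ S := fun h => lt_irrefl _ (ha a h)
  have hmem : ∀ s : (insert a S : Finset ℕ), (s : ℕ) ≠ a → (s : ℕ) ∈ S := fun s h =>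
    (Finset.mem_insert.1 s.2).resolve_left h
  have hlt : ∀ s : S, (⟨a, Finset.mem_insert_self a S⟩ : (insert a S : Finset ℕ)) <
    ⟨s, Finset.mem_insert_of_mem s.2⟩ := fun s => ha s s.2
  refine Nat.card_eq_of_bijective
    (fun w => (⟨w.1 ⟨a, Finset.mem_insert_self a S⟩, ?_⟩,
      ⟨fun s => (w.1 ⟨s, Finset.mem_insert_of_mem s.2⟩).drop
        (w.1 ⟨a, Finset.mem_insert_self a S⟩).length, ?_, ?_⟩)) ⟨?_, ?_⟩
  · have := w.2.1 ⟨a, Finset.mem_insert_self a S⟩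
    simp only at this
    omega
  · intro s
    have h := (w.2.2 _ _ (hlt s)).2
    have h' := (w.2.2 _ _ (hlt s)).1.length_le
    simp only [List.length_drop] at h ⊢
    omega
  · intro s s' hss
    obtain ⟨h1, h2⟩ :=
      w.2.2 ⟨s, Finset.mem_insert_of_mem s.2⟩ ⟨s', Finset.mem_insert_of_mem s'.2⟩ hss
    have h3 := (w.2.2 _ _ (hlt s)).1.length_le
    have h4 := (w.2.2 _ _ (hlt s')).1.length_le
    refine ⟨h1.drop _, ?_⟩
    simp only [List.length_drop] at h2 ⊢
    omega
  · intro w w' h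
    simp only [Prod.mk.injEq, Subtype.mk.injEq] at h
    obtain ⟨h1, h2⟩ := h
    ext1
    funext s
    by_cases hs : (s : ℕ) = a
    · obtain rfl : s = ⟨a, Finset.mem_insert_self a S⟩ := Subtype.ext hs
      exact h1
    · have h3 := congrFun h2 ⟨s, hmem s hs⟩
      obtain ⟨u, hu⟩ := (w.2.2 _ _ (hlt ⟨s, hmem s hs⟩)).1
      obtain ⟨u', hu'⟩ := (w'.2.2 _ _ (hlt ⟨s, hmem s hs⟩)).1
      simp only [← hu, ← hu', List.drop_left] at h3
      change w.1 ⟨s, _⟩ = w'.1 ⟨s, _⟩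
      rw [← hu, ← hu', h1, h3]
  · rintro ⟨⟨u, hu⟩, ⟨v, hv1, hv2⟩⟩
    refine ⟨⟨fun s => if h : (s : ℕ) = a then u else u ++ v ⟨s, hmem s h⟩, fun s => ?_,
      fun s s' hss => ?_⟩, ?_⟩
    · dsimp only
      split_ifs with h
      · omega
      · have := hv1 ⟨s, hmem s h⟩
        simp only [List.length_append] at this ⊢
        omega
    · have hss' : (s : ℕ) < s' := hss
      have h' : (s' : ℕ) ≠ a := by
        rintro h'
        rcases Finset.mem_insert.1 s.2 with h | h
        · omega
        · have := ha _ h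
          omega
      simp only [h', dite_false]
      have h1 := hv1 ⟨s', hmem s' h'⟩
      split_ifs with h
      · refine ⟨List.prefix_append _ _, ?_⟩
        simp only [List.length_append] at h1 ⊢
        omega
      · have h2 := hv2 ⟨s, hmem s h⟩ ⟨s', hmem s' h'⟩ hss
        refine ⟨(List.prefix_append_right_inj _).2 h2.1, ?_⟩
        have := h2.2
        simp only [List.length_append] at this ⊢
        omega
    · have hne : ∀ s : S, (s : ℕ) ≠ a := fun s h => haS (h ▸ s.2)
      simp [hne]

theorem card_wordSystem (t : ℕ) (S : Finset ℕ) : ∀ m : ℕ, (∀ s ∈ S, m ≤ s) →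
    (Nat.card (WordSystem t m S) : ℤ) = (phiAux m (S.sort (· ≤ ·))).eval (t : ℤ) := by
  induction S using Finset.induction_on_min with
  | empty =>
    intro m _
    have : Unique (WordSystem t m ∅) :=
      { default := ⟨fun s => absurd s.2 (Finset.notMem_empty _),
          fun s => absurd s.2 (Finset.notMem_empty _),
          fun s => absurd s.2 (Finset.notMem_empty _)⟩
        uniq := fun w => Subtype.ext (funext fun s => absurd s.2 (Finset.notMem_empty _)) }
    simp [phiAux]
  | insert a S ha ih =>
    intro m hm
    rw [card_wordSystem_insert t m a S (hm a (Finset.mem_insert_self _ _)) ha, Nat.card_prod,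
      Finset.sort_insert (r := (· ≤ ·)) (fun s hs => (ha s hs).le) (fun h => lt_irrefl _ (ha a h)),
      phiAux, Polynomial.eval_mul, ← ih a fun s hs => (ha s hs).le, Nat.cast_mul,
      card_words_length_le]

end Words

section Graded

variable {P : Type} [Finite P] [PartialOrder P] {rk : P → ℕ}

theorem rank_lt_of_lt (hgraded : ∀ x y : P, x ⋖ y → rk y = rk x + 1) :
    ∀ x y : P, x < y → rk x < rk y := by
  intro x
  induction x using (wellFounded_gt (α := P)).induction with
  | _ x ih =>
    intro y hxy
    obtain ⟨z, hxz, hzy⟩ := exists_covBy_le_of_lt hxy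
    have hz := hgraded x z hxz
    rcases hzy.lt_or_eq with h | rfl
    · have := ih z hxz.lt y h
      omega
    · omega

theorem exists_rank_eq_between (hgraded : ∀ x y : P, x ⋖ y → rk y = rk x + 1) :
    ∀ (x y : P) (s : ℕ), x ≤ y → rk x ≤ s → s ≤ rk y → ∃ z, x ≤ z ∧ z ≤ y ∧ rk z = s := by
  intro x
  induction x using (wellFounded_gt (α := P)).induction with
  | _ x ih =>
    intro y s hxy hx hy
    rcases hx.lt_or_eq with h | h
    · obtain ⟨z, hxz, hzy⟩ := exists_covBy_le_of_lt (hxy.lt_of_ne (by rintro rfl; omega))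
      have hz := hgraded x z hxz
      obtain ⟨u, hu, hu'⟩ := ih z hxz.lt y s hzy (by omega) hy
      exact ⟨u, hxz.le.trans hu, hu'⟩
    · exact ⟨x, le_rfl, hxy, h⟩

theorem exists_rank_eq_reesLe_between {t : ℕ} (hgraded : ∀ x y : P, x ⋖ y → rk y = rk x + 1)
    (a b : P × List (Fin t)) (s : ℕ) (hab : reesLe P rk a b) (ha : rk a.1 ≤ s)
    (hb : s ≤ rk b.1) : ∃ c, reesLe P rk a c ∧ reesLe P rk c b ∧ rk c.1 = s := by
  obtain ⟨h1, h2, h3⟩ := hab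
  obtain ⟨p, hap, hpb, rfl⟩ := exists_rank_eq_between hgraded a.1 b.1 s h1 ha hb
  have hlen := h2.length_le
  refine ⟨(p, b.2.take (a.2.length + (rk p - rk a.1))), ⟨hap, ?_, ?_⟩,
    ⟨hpb, List.take_prefix _ _, ?_⟩, rfl⟩
  · rw [List.prefix_take_iff]
    exact ⟨h2, by omega⟩
  · simp only [List.length_take]
    omega
  · simp only [List.length_take]
    omega

end Graded

theorem reesLe_trans {P : Type} [PartialOrder P] {rk : P → ℕ} {t : ℕ}
    {a b c : P × List (Fin t)} (hab : reesLe P rk a b) (hbc : reesLe P rk b c) :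
    reesLe P rk a c :=
  ⟨hab.1.trans hbc.1, hab.2.1.trans hbc.2.1, by have := hab.2.2; have := hbc.2.2; omega⟩

section ReesPoset

variable {P : Type} [PartialOrder P] [BoundedOrder P] {rk : P → ℕ} {t n : ℕ}

theorem QLe_trans (x y z : QType P rk t n) (hxy : QLe P rk t n x y) (hyz : QLe P rk t n y z) :
    QLe P rk t n x z := by
  rcases x with _ | _ | x <;> rcases y with _ | _ | y <;> rcases z with _ | _ | z <;>
    simp_all [QLe]
  exact reesLe_trans hxy hyz

theorem QRank_lt_of_QLe [Finite P] (hrk_bot : rk ⊥ = 0) (hrk_top : rk ⊤ = n + 1)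
    (hgraded : ∀ x y : P, x ⋖ y → rk y = rk x + 1) (x y : QType P rk t n)
    (hxy : QLe P rk t n x y) (hne : x ≠ y) : QRank P rk t n x < QRank P rk t n y := by
  rcases x with _ | _ | ⟨⟨p, u⟩, h1, h2, h3, h4⟩ <;>
    rcases y with _ | _ | ⟨⟨p', u'⟩, h1', h2', h3', h4'⟩ <;> simp only [QLe, QRank] at *
  · exact absurd rfl hne
  · omega
  · rcases (bot_le (a := p')).lt_or_eq with h | rfl
    · have := rank_lt_of_lt hgraded _ _ h
      omega
    · exact absurd ⟨rfl, (List.length_eq_zero_iff (l := u')).1 (by simp only at h3'; omega)⟩ h4'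
  · exact absurd hxy (by simp)
  · exact absurd rfl hne
  · exact absurd hxy (by simp)
  · have := rank_lt_of_lt hgraded p ⊤ (lt_top_iff_ne_top.2 h1)
    omega
  · obtain ⟨hp, hu, hl⟩ := hxy
    rcases hp.lt_or_eq with h | h
    · exact rank_lt_of_lt hgraded _ _ h
    · simp only at h hu hl
      subst h
      exact absurd (by simp [hu.eq_of_length_le (by omega)]) hne

theorem exists_QRank_eq_between [Finite P] (hrk_bot : rk ⊥ = 0) (hrk_top : rk ⊤ = n + 1)
    (hgraded : ∀ x y : P, x ⋖ y → rk y = rk x + 1) (x y : QType P rk t n) (s : ℕ)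
    (hxy : QLe P rk t n x y) (hx : QRank P rk t n x < s) (hy : s < QRank P rk t n y) :
    ∃ z, QLe P rk t n x z ∧ QLe P rk t n z y ∧ QRank P rk t n z = s := by
  have core : ∀ c : P × List (Fin t), rk c.1 = s → 0 < s → s < n + 1 → c.2.length ≤ rk c.1 →
      c.1 ≠ ⊤ ∧ c.2.length ≤ n ∧ c.2.length ≤ rk c.1 ∧ ¬(c.1 = ⊥ ∧ c.2 = []) := by
    rintro ⟨p, u⟩ hp hs hs' hu
    simp only at hp hu ⊢
    refine ⟨?_, by omega, hu, ?_⟩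
    · rintro rfl
      omega
    · rintro ⟨rfl, _⟩
      omega
  rcases x with _ | _ | ⟨a, ha⟩ <;> rcases y with _ | _ | ⟨b, hb⟩ <;> simp only [QRank] at hx hy
  · omega
  · obtain ⟨p, -, -, hp⟩ := exists_rank_eq_between hgraded ⊥ ⊤ s bot_le (by omega) (by omega)
    exact ⟨some (some ⟨(p, []), core _ hp hx hy (by simp)⟩), trivial, trivial, hp⟩
  · obtain ⟨c, h1, h2, hc⟩ := exists_rank_eq_reesLe_between hgraded (⊥, []) b s
      ⟨bot_le, List.nil_prefix, by have := hb.2.2.1; simp; omega⟩ (by simp; omega) hy.le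
    have hbt := rank_lt_of_lt hgraded _ _ (lt_top_iff_ne_top.2 hb.1)
    have := h1.2.2
    exact ⟨some (some ⟨c, core c hc hx (by omega) (by simp at this; omega)⟩), trivial, h2, hc⟩
  · exact absurd hxy (by simp [QLe])
  · omega
  · exact absurd hxy (by simp [QLe])
  · exact absurd hxy (by simp [QLe])
  · obtain ⟨p, h1, -, hp⟩ := exists_rank_eq_between hgraded a.1 ⊤ s le_top (by omega) (by omega)
    have := ha.2.2.1
    exact ⟨some (some ⟨(p, a.2), core _ hp (by omega) hy (by simp; omega)⟩),
      ⟨h1, List.prefix_refl _, by simp; omega⟩, trivial, hp⟩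
  · obtain ⟨c, h1, h2, hc⟩ := exists_rank_eq_reesLe_between hgraded a b s hxy hx.le hy.le
    have hbt := rank_lt_of_lt hgraded _ _ (lt_top_iff_ne_top.2 hb.1)
    have := h1.2.2
    have := ha.2.2.1
    exact ⟨some (some ⟨c, core c hc (by omega) (by omega) (by omega)⟩), h1, h2, hc⟩

/-- A section of the rank function of `Q` is a section of the rank function of `P` together with
an independent system of words. -/
theorem card_rankSection_Q {G : Type} [Group G] [MulAction G P] (hrk_bot : rk ⊥ = 0)
    (hrk_top : rk ⊤ = n + 1) (S : Finset ℕ) (hS : ∀ s ∈ S, 0 < s ∧ s < n + 1) (g : G) :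
    Nat.card (RankSection (QLe P rk t n) (QRank P rk t n) S (QFix P G rk t n g)) =
      Nat.card (WordSystem t 0 S × RankSection (· ≤ ·) rk S fun x : P => g • x = x) := by
  symm
  refine Nat.card_eq_of_bijective
    (fun wp => ⟨fun s => some (some ⟨(wp.2.1 s, wp.1.1 s), ?_, ?_, ?_, ?_⟩), ?_, ?_, ?_⟩)
    ⟨?_, ?_⟩
  · intro h
    have h1 := wp.2.2.1 s
    have h2 := hS s s.2
    simp only at h
    rw [h] at h1
    omega
  · have h1 := wp.1.2.1 s
    have h2 := hS s s.2
    simp only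
    omega
  · have h1 := wp.1.2.1 s
    have h2 := wp.2.2.1 s
    simp only
    omega
  · rintro ⟨h, -⟩
    have h1 := wp.2.2.1 s
    have h2 := hS s s.2
    simp only at h
    rw [h] at h1
    omega
  · exact wp.2.2.1
  · intro s s' h
    obtain ⟨h1, h2⟩ := wp.1.2.2 s s' h
    refine ⟨wp.2.2.2.1 s s' h, h1, ?_⟩
    have h3 := wp.2.2.1 s
    have h4 := wp.2.2.1 s'
    simp only
    omega
  · exact wp.2.2.2.2
  · rintro ⟨⟨w, _⟩, ⟨p, _⟩⟩ ⟨⟨w', _⟩, ⟨p', _⟩⟩ h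
    have h' := fun s => congrFun (congrArg Subtype.val h) s
    simp only [Option.some.injEq, Subtype.mk.injEq, Prod.mk.injEq] at h'
    obtain rfl : w = w' := funext fun s => (h' s).2
    obtain rfl : p = p' := funext fun s => (h' s).1
    rfl
  · rintro ⟨f, hf1, hf2, hf3⟩
    have hex : ∀ s : S, ∃ c : QCore P rk t n, f s = some (some c) := by
      intro s
      have h1 := hf1 s
      have h2 := hS s s.2
      rcases hfs : f s with _ | _ | c
      · rw [hfs] at h1
        simp only [QRank] at h1
        omega
      · rw [hfs] at h1
        simp only [QRank] at h1
        omega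
      · exact ⟨c, rfl⟩
    choose c hc using hex
    obtain rfl : f = fun s => some (some (c s)) := funext hc
    refine ⟨(⟨fun s => (c s).1.2, fun s => ?_, fun s s' h => ⟨(hf2 s s' h).2.1, ?_⟩⟩,
      ⟨fun s => (c s).1.1, hf1, fun s s' h => (hf2 s s' h).1, hf3⟩), rfl⟩
    · have h1 : rk (c s).1.1 = s := hf1 s
      have h2 := (c s).2.2.2.1
      simp only
      omega
    · have h1 : rk (c s).1.1 = s := hf1 s
      have h2 : rk (c s').1.1 = s' := hf1 s'
      have h3 := (hf2 s s' h).2.2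
      simp only
      omega

end ReesPoset

theorem alphaQ_eq_phi_mul_alphaP (n t : ℕ) (hn : 1 ≤ n) (ht : 1 ≤ t)
    (P : Type) [Fintype P] [PartialOrder P] [BoundedOrder P] (rk : P → ℕ)
    (hrk_bot : rk ⊥ = 0) (hrk_top : rk ⊤ = n + 1)
    (hgraded : ∀ x y : P, x ⋖ y → rk y = rk x + 1)
    (G : Type) [Group G] [Fintype G] [MulAction G P]
    (hact : ∀ (g : G) (x y : P), x ≤ y → g • x ≤ g • y)
    (S : Finset ℕ) (hS : S ⊆ Finset.Icc 1 n) (g : G) :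
    (alphaQ P G rk t n S g : ℤ) = (phi S).eval (t : ℤ) * (alphaP P G rk S g : ℤ) := by
  have hS' : ∀ s ∈ S, 0 < s ∧ s < n + 1 := fun s hs => by
    have := Finset.mem_Icc.1 (hS hs)
    omega
  have strict := rank_lt_of_lt hgraded
  have hP : alphaP P G rk S g = Nat.card (RankSection (· ≤ ·) rk S fun x : P => g • x = x) := by
    refine nFixedMaxChains_eq_card_rankSection (r := (· ≤ ·)) (ρ := rk) (S := S)
      (bot := ⊥) (top := ⊤) (fun _ _ _ => le_trans)
      (fun x y h hne => strict x y (h.lt_of_ne hne))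
      (fun x y s h h1 h2 => exists_rank_eq_between hgraded x y s h h1.le h2.le)
      (fun _ => bot_le) (fun _ => le_top) (by rwa [hrk_bot, hrk_top]) ?_ ?_
    · have := hact g ⊥ (g⁻¹ • ⊥) bot_le
      rw [smul_inv_smul] at this
      exact le_bot_iff.1 this
    · have := hact g (g⁻¹ • ⊤) ⊤ le_top
      rw [smul_inv_smul] at this
      exact top_le_iff.1 this
  have hQ : alphaQ P G rk t n S g =
      Nat.card (RankSection (QLe P rk t n) (QRank P rk t n) S (QFix P G rk t n g)) := by
    refine nFixedMaxChains_eq_card_rankSection (bot := none) (top := some none) QLe_trans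
      (QRank_lt_of_QLe hrk_bot hrk_top hgraded)
      (exists_QRank_eq_between hrk_bot hrk_top hgraded) (fun _ => trivial) ?_ hS' trivial trivial
    rintro (_ | _ | _)
    · trivial
    · rfl
    · trivial
  rw [hP, hQ, card_rankSection_Q hrk_bot hrk_top S hS' g, Nat.card_prod, Nat.cast_mul,
    card_wordSystem t S 0 fun _ _ => Nat.zero_le _, phi]

end
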